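/- Every finite subgroup of SO(3) is isomorphic to a cyclic group, a dihedral group, A₄, S₄, or A₅. -/

import Mathlib

open Matrix

section GroupTheory

open MulAction

variable {G P : Type*} [Group G] [MulAction G P]

/-- Double counting of the pairs `(a, y)` with `a ∈ A` fixing `y`. -/
theorem sum_ncard_inter_stabilizer [Finite G] [Fintype P]
    (hfix : ∀ g : G, g ≠ 1 → (fixedBy P g).ncard = 2) (A : Set G) (hA : 1 ∉ A) :
    ∑ y : P, (A ∩ stabilizer G y).ncard = 2 * A.ncard := by
  classical
  have := Fintype.ofFinite G
  have key := Finset.sum_card_bipartiteAbove_eq_sum_card_bipartiteBelow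
    (fun (y : P) (g : G) ↦ g • y = y) (s := Finset.univ) (t := A.toFinset)
  have hleft : ∀ y : P, (A ∩ stabilizer G y).ncard =
      (Finset.bipartiteAbove (fun (y : P) (g : G) ↦ g • y = y) A.toFinset y).card := by
    intro y
    rw [← Set.ncard_coe_finset]
    congr 1
    ext g
    simp [Finset.bipartiteAbove]
  have hright : ∀ g ∈ A.toFinset,
      (Finset.bipartiteBelow (fun (y : P) (g : G) ↦ g • y = y) Finset.univ g).card = 2 := by
    intro g hg
    rw [← hfix g (by rintro rfl; simp_all), ← Set.ncard_coe_finset]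
    congr 1
    ext y
    simp [Finset.bipartiteBelow]
  rw [Finset.sum_congr rfl fun y _ ↦ hleft y, key, Finset.sum_congr rfl hright,
    Finset.sum_const, smul_eq_mul, mul_comm, Set.ncard_eq_toFinset_card']

theorem ncard_inter_stabilizer_smul (A : Set G)
    (hconj : ∀ g, ∀ a ∈ A, g * a * g⁻¹ ∈ A) (h : G) (y : P) :
    (A ∩ stabilizer G (h • y)).ncard = (A ∩ stabilizer G y).ncard := by
  have : A ∩ stabilizer G (h • y) = (fun a ↦ h * a * h⁻¹) '' (A ∩ stabilizer G y) := by
    ext a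
    constructor
    · rintro ⟨ha, hy⟩
      refine ⟨h⁻¹ * a * h, ⟨by simpa using hconj h⁻¹ a ha, ?_⟩, by group⟩
      simp only [SetLike.mem_coe, mem_stabilizer_iff] at hy ⊢
      rw [mul_smul, mul_smul, hy, inv_smul_smul]
    · rintro ⟨b, ⟨hb, hy⟩, rfl⟩
      refine ⟨hconj h b hb, ?_⟩
      simp only [SetLike.mem_coe, mem_stabilizer_iff] at hy ⊢
      rw [mul_smul, mul_smul, inv_smul_smul, hy]
  rw [this]
  exact Set.ncard_image_of_injective _ fun a b hab ↦ by simpa using hab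

/-- The double count for a conjugation-invariant set `A`, grouped by orbits. -/
theorem two_mul_ncard_eq_sum_orbits [Finite G] [Finite P] [Fintype (orbitRel.Quotient G P)]
    (hfix : ∀ g : G, g ≠ 1 → (fixedBy P g).ncard = 2) (A : Set G) (hA : 1 ∉ A)
    (hconj : ∀ g, ∀ a ∈ A, g * a * g⁻¹ ∈ A) :
    2 * A.ncard = ∑ ω : orbitRel.Quotient G P,
      (orbit G ω.out).ncard * (A ∩ stabilizer G ω.out).ncard := by
  classical
  have := Fintype.ofFinite P
  rw [← sum_ncard_inter_stabilizer hfix A hA, ← Finset.sum_fiberwise Finset.univ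
    (fun y : P ↦ (Quotient.mk'' y : orbitRel.Quotient G P))]
  refine Finset.sum_congr rfl fun ω _ ↦ ?_
  have hmem : ∀ y : P, (Quotient.mk'' y : orbitRel.Quotient G P) = ω ↔ y ∈ orbit G ω.out := by
    intro y
    rw [← orbitRel.Quotient.orbit_eq_orbit_out ω Quotient.out_eq', orbitRel.Quotient.mem_orbit]
  rw [Finset.sum_congr rfl (g := fun _ ↦ (A ∩ stabilizer G ω.out).ncard), Finset.sum_const,
    smul_eq_mul, ← Set.ncard_coe_finset]
  · congr 2
    ext y
    simp [hmem]
  · intro y hy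
    obtain ⟨h, rfl⟩ := (hmem y).1 (by simpa using hy)
    exact ncard_inter_stabilizer_smul A hconj h _

theorem ncard_orbit_mul_card_stabilizer (y : P) :
    (orbit G y).ncard * Nat.card (stabilizer G y) = Nat.card G := by
  rw [← index_stabilizer, mul_comm, Subgroup.card_mul_index]

theorem card_stabilizer_eq_of_mem_orbit {y z : P} (h : z ∈ orbit G y) :
    Nat.card (stabilizer G z) = Nat.card (stabilizer G y) := by
  obtain ⟨g, rfl⟩ := h
  exact Nat.card_congr (stabilizerEquivStabilizer rfl).symm.toEquiv

/-- The orbit sizes `o` and stabilizer orders `r`, with `r` increasing, in the case of three orbits. -/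
theorem three_orbits_cases {n : ℕ} {o r : Fin 3 → ℕ} (hor : ∀ i, o i * r i = n)
    (hr : ∀ i, 2 ≤ r i) (hmono : Monotone r) (hsum : o 0 + o 1 + o 2 = n + 2) :
    (r 0 = 2 ∧ r 1 = 2 ∧ n = 2 * r 2) ∨
    (n = 12 ∧ r 0 = 2 ∧ r 1 = 3 ∧ r 2 = 3) ∨
    (n = 24 ∧ r 0 = 2 ∧ r 1 = 3 ∧ r 2 = 4) ∨
    (n = 60 ∧ r 0 = 2 ∧ r 1 = 3 ∧ r 2 = 5) := by
  have h0 := hor 0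
  have h1 := hor 1
  have h2 := hor 2
  have hr0 := hr 0
  have h01 : r 0 ≤ r 1 := hmono (by decide)
  have h12 : r 1 ≤ r 2 := hmono (by decide)
  generalize o 0 = x, o 1 = y, o 2 = z, r 0 = a, r 1 = b, r 2 = c at *
  have ha : a = 2 := by
    by_contra h
    have e0 : x * 3 ≤ x * a := Nat.mul_le_mul_left _ (by omega)
    have e1 : y * 3 ≤ y * b := Nat.mul_le_mul_left _ (by omega)
    have e2 : z * 3 ≤ z * c := Nat.mul_le_mul_left _ (by omega)
    omega
  subst ha
  have hb : b < 4 := by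
    by_contra h
    have e1 : y * 4 ≤ y * b := Nat.mul_le_mul_left _ (by omega)
    have e2 : z * 4 ≤ z * c := Nat.mul_le_mul_left _ (by omega)
    omega
  obtain rfl | rfl : b = 2 ∨ b = 3 := by omega
  · obtain rfl : z = 2 := by omega
    omega
  · have hc : c < 6 := by
      by_contra h
      have e2 : z * 6 ≤ z * c := Nat.mul_le_mul_left _ (by omega)
      omega
    obtain rfl | rfl | rfl : c = 3 ∨ c = 4 ∨ c = 5 := by omega
    all_goals omega

theorem ncard_sdiff_one (K : Subgroup G) : ((K : Set G) \ {1}).ncard = Nat.card K - 1 := by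
  rw [Set.ncard_sdiff_singleton_of_mem (one_mem _), ← Nat.card_coe_set_eq]
  rfl

/-- A finite group acting on a finite set with non-trivial stabilizers, every non-trivial element
fixing exactly two points, either fixes a point or has three orbits of a restricted type. -/
theorem exists_stabilizer_eq_top_or_three_orbits [Finite G] [Nontrivial G] [Finite P]
    (hfix : ∀ g : G, g ≠ 1 → (fixedBy P g).ncard = 2) (hstab : ∀ y : P, stabilizer G y ≠ ⊥) :
    (∃ y : P, stabilizer G y = ⊤) ∨
    ∃ x : Fin 3 → P, (∀ y, ∃ i, y ∈ orbit G (x i)) ∧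
      (∀ A : Set G, 1 ∉ A → (∀ g, ∀ a ∈ A, g * a * g⁻¹ ∈ A) →
        2 * A.ncard = ∑ i, (orbit G (x i)).ncard * (A ∩ stabilizer G (x i)).ncard) ∧
      ((Nat.card (stabilizer G (x 0)) = 2 ∧ Nat.card (stabilizer G (x 1)) = 2 ∧
          Nat.card G = 2 * Nat.card (stabilizer G (x 2))) ∨
        (Nat.card G = 12 ∧ Nat.card (stabilizer G (x 0)) = 2 ∧
          Nat.card (stabilizer G (x 1)) = 3 ∧ Nat.card (stabilizer G (x 2)) = 3) ∨
        (Nat.card G = 24 ∧ Nat.card (stabilizer G (x 0)) = 2 ∧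
          Nat.card (stabilizer G (x 1)) = 3 ∧ Nat.card (stabilizer G (x 2)) = 4) ∨
        (Nat.card G = 60 ∧ Nat.card (stabilizer G (x 0)) = 2 ∧
          Nat.card (stabilizer G (x 1)) = 3 ∧ Nat.card (stabilizer G (x 2)) = 5)) := by
  classical
  have := Fintype.ofFinite (orbitRel.Quotient G P)
  have hn : 2 ≤ Nat.card G := Finite.one_lt_card
  have hor (y : P) := ncard_orbit_mul_card_stabilizer (G := G) y
  have hr (y : P) : 2 ≤ Nat.card (stabilizer G y) :=
    (Subgroup.one_lt_card_iff_ne_bot _).2 (hstab y)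
  have hdiff (y : P) : (orbit G y).ncard * (({1}ᶜ : Set G) ∩ stabilizer G y).ncard +
      (orbit G y).ncard = Nat.card G := by
    have : ({1}ᶜ : Set G) ∩ stabilizer G y = (stabilizer G y : Set G) \ {1} := by
      ext; simp [and_comm]
    rw [this, ncard_sdiff_one, ← hor y, ← Nat.mul_succ]
    congr 1
    have := hr y
    omega
  have hhalf (y : P) : 2 * (orbit G y).ncard ≤ Nat.card G := by
    rw [← hor y, mul_comm]
    exact Nat.mul_le_mul_left _ (hr y)
  have hpos (y : P) : 0 < (orbit G y).ncard :=
    Nat.pos_of_ne_zero fun h ↦ by have := hor y; rw [h] at this; omega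
  have hmain := two_mul_ncard_eq_sum_orbits hfix ({1}ᶜ : Set G) (by simp)
    (fun g a ha ↦ by simpa using ha)
  have hcompl : ({1}ᶜ : Set G).ncard + 1 = Nat.card G := by
    have := Set.ncard_add_ncard_compl ({1} : Set G)
    simp only [Set.ncard_singleton] at this
    omega
  have hsum : 2 * ({1}ᶜ : Set G).ncard + ∑ ω : orbitRel.Quotient G P, (orbit G ω.out).ncard =
      Fintype.card (orbitRel.Quotient G P) * Nat.card G := by
    rw [hmain, ← Finset.sum_add_distrib, Finset.sum_congr rfl fun ω _ ↦ hdiff _]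
    simp
  have hbound : 2 * ∑ ω : orbitRel.Quotient G P, (orbit G ω.out).ncard ≤
      Fintype.card (orbitRel.Quotient G P) * Nat.card G := by
    rw [Finset.mul_sum]
    refine (Finset.sum_le_card_nsmul _ _ _ fun ω _ ↦ hhalf _).trans ?_
    simp
  obtain ⟨k, hk⟩ : ∃ k, Fintype.card (orbitRel.Quotient G P) = k := ⟨_, rfl⟩
  have e := Fintype.equivFinOfCardEq hk
  rw [hk] at hsum hbound
  have hk4 : k < 4 := by
    by_contra h
    have : 4 * Nat.card G ≤ k * Nat.card G := Nat.mul_le_mul_right _ (by omega)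
    omega
  rw [← e.symm.sum_comp] at hsum
  interval_cases k
  · simp at hsum
    omega
  · simp only [Fin.sum_univ_one] at hsum
    have := hpos (e.symm 0).out
    omega
  · simp only [Fin.sum_univ_two] at hsum
    have h0 := hpos (e.symm 0).out
    have h1 := hpos (e.symm 1).out
    refine .inl ⟨(e.symm 0).out, Subgroup.eq_top_of_card_eq _ ?_⟩
    have := hor (e.symm 0).out
    rwa [show (orbit G (e.symm 0).out).ncard = 1 by omega, one_mul] at this
  · right
    let r : Fin 3 → ℕ := fun i ↦ Nat.card (stabilizer G (e.symm i).out)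
    let e' : Fin 3 ≃ orbitRel.Quotient G P := (Tuple.sort r).trans e.symm
    rw [← Equiv.sum_comp (Tuple.sort r)] at hsum
    refine ⟨fun i ↦ (e' i).out, fun y ↦ ⟨e'.symm (Quotient.mk'' y), ?_⟩, fun A hA hconj ↦ ?_, ?_⟩
    · beta_reduce
      rw [e'.apply_symm_apply, ← orbitRel.Quotient.orbit_eq_orbit_out _ Quotient.out_eq',
        orbitRel.Quotient.mem_orbit]
    · rw [two_mul_ncard_eq_sum_orbits hfix A hA hconj, ← e'.sum_comp]
    · refine three_orbits_cases (o := fun i ↦ (orbit G (e' i).out).ncard)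
        (r := fun i ↦ Nat.card (stabilizer G (e' i).out)) (fun i ↦ hor _)
        (fun i ↦ hr _) (Tuple.monotone_sort r) ?_
      simp only [Fin.sum_univ_three] at hsum
      simp only [e', Equiv.trans_apply]
      omega

theorem nonempty_mulEquiv_perm [Finite G] {X : Type*} {m : ℕ} {f : G →* Equiv.Perm X}
    (hf : Function.Injective f) (hX : Nat.card X = m) (hm : m ≠ 0) (hG : Nat.card G = m.factorial) :
    Nonempty (G ≃* Equiv.Perm (Fin m)) := by
  have : Finite X := Nat.finite_of_card_ne_zero (hX ▸ hm)
  let c := (Finite.equivFinOfCardEq hX).permCongrHom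
  have hinj : Function.Injective (c.toMonoidHom.comp f) := c.injective.comp hf
  refine ⟨MulEquiv.ofBijective _ ((Nat.bijective_iff_injective_and_card _).2 ⟨hinj, ?_⟩)⟩
  rw [hG, Nat.card_perm, Nat.card_fin]

theorem nonempty_mulEquiv_alternatingGroup {X : Type*} {m : ℕ} {f : G →* Equiv.Perm X}
    (hf : Function.Injective f) (hX : Nat.card X = m) (hm : m ≠ 0)
    (hG : 2 * Nat.card G = m.factorial) : Nonempty (G ≃* alternatingGroup (Fin m)) := by
  have : Finite X := Nat.finite_of_card_ne_zero (hX ▸ hm)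
  let c := (Finite.equivFinOfCardEq hX).permCongrHom
  have hinj : Function.Injective (c.toMonoidHom.comp f) := c.injective.comp hf
  have hcard : Nat.card (c.toMonoidHom.comp f).range = Nat.card G :=
    (Nat.card_congr (MonoidHom.ofInjective hinj).toEquiv).symm
  have hindex : (c.toMonoidHom.comp f).range.index = 2 := by
    have := (c.toMonoidHom.comp f).range.card_mul_index
    rw [hcard, Nat.card_perm, Nat.card_fin, ← hG, mul_comm] at this
    have hpos : 0 < Nat.card G := by
      have := m.factorial_pos
      omega
    exact Nat.eq_of_mul_eq_mul_right hpos this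
  exact ⟨(MonoidHom.ofInjective hinj).trans
    (MulEquiv.subgroupCongr (Equiv.Perm.eq_alternatingGroup_of_index_eq_two hindex))⟩

/-- A group with an index two cyclic subgroup outside of which every element is an involution is
dihedral. -/
theorem nonempty_mulEquiv_dihedralGroup [Finite G] (C : Subgroup G) [IsCyclic C] {m : ℕ}
    (hC : Nat.card C = m) (hG : Nat.card G = 2 * m) (hinv : ∀ g ∉ C, g * g = 1) :
    Nonempty (G ≃* DihedralGroup m) := by
  have hmpos : 0 < m := hC ▸ Nat.card_pos
  have : NeZero m := ⟨hmpos.ne'⟩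
  obtain ⟨c, hc⟩ := IsCyclic.exists_ofOrder_eq_natCard (α := C)
  rw [hC, ← Subgroup.orderOf_coe] at hc
  obtain ⟨s, hs⟩ : ∃ s, s ∉ C := by
    by_contra! h
    rw [(Subgroup.eq_top_iff' C).2 h, Subgroup.card_top] at hC
    omega
  have hpow (i : ZMod m) : (c : G) ^ i.val ∈ C := pow_mem c.2 _
  have hadd (i j : ZMod m) : (c : G) ^ (i + j).val = (c : G) ^ i.val * (c : G) ^ j.val := by
    rw [← pow_add, pow_eq_pow_iff_modEq, hc, ZMod.val_add]
    exact Nat.mod_modEq _ _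
  have hnot {g : G} (hg : g ∈ C) : s * g ∉ C := fun h ↦
    hs ((Subgroup.mul_mem_cancel_right C hg).1 h)
  have hss : s * s = 1 := hinv s hs
  have hconj {g : G} (hg : g ∈ C) : g * s = s * g⁻¹ := by
    have h := hinv _ (hnot hg)
    rw [eq_mul_inv_iff_mul_eq, ← mul_right_inj s, hss, ← h]
    group
  have hsub (i j : ZMod m) : (c : G) ^ (j - i).val = ((c : G) ^ i.val)⁻¹ * (c : G) ^ j.val := by
    rw [eq_inv_mul_iff_mul_eq, ← hadd, add_sub_cancel]
  let φ : DihedralGroup m → G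
    | .r i => (c : G) ^ i.val
    | .sr i => s * (c : G) ^ i.val
  let f : DihedralGroup m →* G := MonoidHom.mk' φ <| by
    rintro (i | i) (j | j)
    · exact hadd i j
    · change s * (c : G) ^ (j - i).val = (c : G) ^ i.val * (s * (c : G) ^ j.val)
      rw [← mul_assoc, hconj (hpow i), hsub, mul_assoc]
    · change s * (c : G) ^ (i + j).val = s * (c : G) ^ i.val * (c : G) ^ j.val
      rw [hadd, mul_assoc]
    · change (c : G) ^ (j - i).val = s * (c : G) ^ i.val * (s * (c : G) ^ j.val)
      rw [mul_assoc, ← mul_assoc _ s, hconj (hpow i), mul_assoc, ← mul_assoc, hss, one_mul, hsub]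
  have hf : Function.Injective f := by
    rw [injective_iff_map_eq_one]
    rintro (i | i) hi
    · change (c : G) ^ i.val = 1 at hi
      have hdvd := orderOf_dvd_of_pow_eq_one hi
      rw [hc] at hdvd
      rw [(ZMod.val_eq_zero i).1 (Nat.eq_zero_of_dvd_of_lt hdvd (ZMod.val_lt i)), DihedralGroup.r_zero]
    · exact absurd (show φ (.sr i) ∈ C from (show φ (.sr i) = 1 from hi) ▸ one_mem C)
        (hnot (hpow i))
  refine ⟨(MulEquiv.ofBijective f ((Nat.bijective_iff_injective_and_card _).2 ⟨hf, ?_⟩)).symm⟩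
  rw [hG, DihedralGroup.nat_card]

/-- If distinct Sylow `p`-subgroups meet trivially and their non-trivial elements have order `p`,
then counting elements of order `p` counts Sylow subgroups. -/
theorem card_sylow_mul_pred [Finite G] {p m : ℕ} [hp : Fact p.Prime]
    (hcard : ∀ S : Sylow p G, Nat.card S = m)
    (hord : ∀ S : Sylow p G, ∀ g ∈ S, g ≠ 1 → orderOf g = p)
    (hdisj : ∀ S T : Sylow p G, ∀ g ∈ S, g ∈ T → g ≠ 1 → S = T) :
    Nat.card (Sylow p G) * (m - 1) = {g : G | orderOf g = p}.ncard := by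
  have := Fintype.ofFinite (Sylow p G)
  have key : Nat.card (Σ S : Sylow p G, ((S : Set G) \ {1} : Set G)) =
      Nat.card {g : G | orderOf g = p} := by
    refine Nat.card_eq_of_bijective (fun x ↦ ⟨x.2, hord x.1 _ x.2.2.1 x.2.2.2⟩) ⟨?_, ?_⟩
    · rintro ⟨S, g, hg⟩ ⟨T, h, hh⟩ heq
      obtain rfl : g = h := congrArg Subtype.val heq
      obtain rfl := hdisj S T g hg.1 hh.1 hg.2
      rfl
    · rintro ⟨g, hg⟩
      obtain ⟨S, hS⟩ := IsPGroup.exists_le_sylow (P := Subgroup.zpowers g)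
        (IsPGroup.of_card (p := p) (n := 1) (by rw [Nat.card_zpowers, hg, pow_one]))
      refine ⟨⟨S, g, hS (Subgroup.mem_zpowers g), ?_⟩, rfl⟩
      rintro rfl
      exact hp.out.one_lt.ne (by simpa using hg)
  rw [← Nat.card_coe_set_eq, ← key, Nat.card_sigma]
  have hS (S : Sylow p G) : Nat.card ((S : Set G) \ {1} : Set G) = m - 1 := by
    rw [Nat.card_coe_set_eq, ← hcard S]
    exact ncard_sdiff_one (S : Subgroup G)
  simp [hS]

/-- The kernel of the conjugation action on Sylow subgroups has order dividing that of a normalizer. -/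
theorem card_ker_toPermHom_sylow_dvd [Finite G] {p k : ℕ} [Fact p.Prime]
    (h : Nat.card G = Nat.card (Sylow p G) * k) :
    Nat.card (toPermHom G (Sylow p G)).ker ∣ k := by
  obtain ⟨S⟩ : Nonempty (Sylow p G) := inferInstance
  have hle : (toPermHom G (Sylow p G)).ker ≤ Subgroup.normalizer (S : Set G) := by
    rw [← Sylow.stabilizer_eq_normalizer]
    intro g hg
    exact DFunLike.congr_fun (MonoidHom.mem_ker.1 hg) S
  have hk : Nat.card (Subgroup.normalizer (S : Set G)) = k := by
    have := (Subgroup.normalizer (S : Set G)).card_mul_index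
    rw [h, mul_comm] at this
    have e := S.card_eq_index_normalizer
    rw [← e] at this
    exact Nat.eq_of_mul_eq_mul_left Nat.card_pos this
  rw [← hk]
  exact Subgroup.card_dvd_of_le hle

theorem two_mul_card_normal_sub_one [Finite G] {x : Fin 3 → P}
    (hcount : ∀ A : Set G, 1 ∉ A → (∀ g, ∀ a ∈ A, g * a * g⁻¹ ∈ A) →
      2 * A.ncard = ∑ i, (orbit G (x i)).ncard * (A ∩ stabilizer G (x i)).ncard)
    (K : Subgroup G) [hK : K.Normal] :
    2 * (Nat.card K - 1) = ∑ i, (orbit G (x i)).ncard *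
      (Nat.card (K ⊓ stabilizer G (x i) : Subgroup G) - 1) := by
  have := hcount ((K : Set G) \ {1}) (by simp) fun g a ⟨ha, h1⟩ ↦
    ⟨hK.conj_mem a ha g, by simpa using h1⟩
  rw [ncard_sdiff_one] at this
  rw [this]
  refine Finset.sum_congr rfl fun i _ ↦ ?_
  rw [← ncard_sdiff_one, Set.sdiff_inter_right_comm, Subgroup.coe_inf]

theorem ncard_orderOf_inter_of_card_eq {p : ℕ} [hp : Fact p.Prime] {K : Subgroup G}
    (hK : Nat.card K = p) : ({g : G | orderOf g = p} ∩ K).ncard = p - 1 := by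
  rw [← hK, ← ncard_sdiff_one]
  congr 1
  ext g
  refine ⟨fun ⟨hg, hgK⟩ ↦ ⟨hgK, ?_⟩, fun ⟨hgK, hg⟩ ↦ ⟨?_, hgK⟩⟩
  · rintro rfl
    simp only [Set.mem_ofPred_eq, orderOf_one, hK] at hg
    exact hp.out.one_lt.ne hg
  · have hdvd := K.orderOf_dvd_natCard hgK
    rw [hK] at hdvd
    exact ((Nat.dvd_prime hp.out).1 hdvd).resolve_left (by simpa using hg) |>.trans hK.symm

theorem ncard_orderOf_inter_of_not_dvd {p : ℕ} {K : Subgroup G} (hK : ¬ p ∣ Nat.card K) :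
    ({g : G | orderOf g = p} ∩ K).ncard = 0 := by
  have : {g : G | orderOf g = p} ∩ K = ∅ := by
    ext g
    simp only [Set.mem_inter_iff, Set.mem_ofPred_eq, SetLike.mem_coe, Set.mem_empty_iff_false,
      iff_false, not_and]
    rintro rfl hg
    exact hK (K.orderOf_dvd_natCard hg)
  rw [this, Set.ncard_empty]

theorem two_mul_ncard_orderOf {x : Fin 3 → P} {p : ℕ} [hp : Fact p.Prime]
    (hcount : ∀ A : Set G, 1 ∉ A → (∀ g, ∀ a ∈ A, g * a * g⁻¹ ∈ A) →
      2 * A.ncard = ∑ i, (orbit G (x i)).ncard * (A ∩ stabilizer G (x i)).ncard) :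
    2 * {g : G | orderOf g = p}.ncard = ∑ i, (orbit G (x i)).ncard *
      ({g : G | orderOf g = p} ∩ stabilizer G (x i)).ncard := by
  refine hcount _ (by simpa using hp.out.one_lt.ne) fun g a ha ↦ ?_
  have := orderOf_injective (MulAut.conj g).toMonoidHom (MulAut.conj g).injective a
  exact this.trans ha

theorem card_inf_dvd_of_card_eq {K L : Subgroup G} {m : ℕ} (hL : Nat.card L = m) :
    Nat.card (K ⊓ L : Subgroup G) ∣ m :=
  hL ▸ Subgroup.card_dvd_of_le (inf_le_right (a := K) (b := L))

theorem card_sylow_eq [Finite G] {p k m : ℕ} [hp : Fact p.Prime] (hG : Nat.card G = p ^ k * m)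
    (hm : ¬ p ∣ m) (S : Sylow p G) : Nat.card S = p ^ k := by
  have := S.card_eq_multiplicity
  rw [hG, Nat.factorization_mul (pow_ne_zero _ hp.out.ne_zero) (by rintro rfl; simp at hm),
    hp.out.factorization_pow] at this
  simpa [Nat.factorization_eq_zero_of_not_dvd hm] using this

theorem exists_mem_stabilizer_of_ne_one (hfix : ∀ g : G, g ≠ 1 → (fixedBy P g).ncard = 2) {g : G}
    (hg : g ≠ 1) : ∃ y : P, g ∈ stabilizer G y := by
  obtain ⟨y, hy⟩ := Set.nonempty_of_ncard_ne_zero (s := fixedBy P g) (by rw [hfix g hg]; simp)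
  exact ⟨y, hy⟩

theorem nonempty_mulEquiv_dihedralGroup_of_orbits [Finite G] {x : Fin 3 → P}
    (hfix : ∀ g : G, g ≠ 1 → (fixedBy P g).ncard = 2)
    (hcyc : ∀ y : P, IsCyclic (stabilizer G y)) (hx : ∀ y, ∃ i, y ∈ orbit G (x i))
    (h0 : Nat.card (stabilizer G (x 0)) = 2) (h1 : Nat.card (stabilizer G (x 1)) = 2)
    (hG : Nat.card G = 2 * Nat.card (stabilizer G (x 2))) :
    Nonempty (G ≃* DihedralGroup (Nat.card (stabilizer G (x 2)))) := by
  have hindex : (stabilizer G (x 2)).index = 2 := by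
    have := (stabilizer G (x 2)).card_mul_index
    rw [hG, mul_comm] at this
    exact Nat.eq_of_mul_eq_mul_right Nat.card_pos this
  have hnormal := Subgroup.normal_of_index_eq_two hindex
  have := hcyc (x 2)
  refine nonempty_mulEquiv_dihedralGroup (stabilizer G (x 2)) rfl hG fun g hg ↦ ?_
  obtain ⟨y, hy⟩ := exists_mem_stabilizer_of_ne_one hfix (show g ≠ 1 by rintro rfl; exact hg (one_mem _))
  have htwo (h : Nat.card (stabilizer G y) = 2) : g * g = 1 := by
    rw [← pow_two]
    exact orderOf_dvd_iff_pow_eq_one.1 (h ▸ Subgroup.orderOf_dvd_natCard _ hy)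
  obtain ⟨i, hi⟩ := hx y
  fin_cases i
  · exact htwo ((card_stabilizer_eq_of_mem_orbit hi).trans h0)
  · exact htwo ((card_stabilizer_eq_of_mem_orbit hi).trans h1)
  · obtain ⟨h, rfl⟩ := hi
    refine absurd ?_ hg
    have : h⁻¹ * g * h ∈ stabilizer G (x 2) := by
      simp only [mem_stabilizer_iff] at hy ⊢
      rw [mul_smul, mul_smul, inv_smul_eq_iff]
      exact hy
    simpa [mul_assoc] using hnormal.conj_mem _ this h

theorem nonempty_mulEquiv_alternatingGroup_four_of_orbit [Finite G] {y : P}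
    (hfix : ∀ g : G, g ≠ 1 → (fixedBy P g).ncard = 2) (hG : Nat.card G = 12)
    (hy : Nat.card (stabilizer G y) = 3) : Nonempty (G ≃* alternatingGroup (Fin 4)) := by
  have hcard : (orbit G y).ncard = 4 := by
    have := ncard_orbit_mul_card_stabilizer (G := G) y
    rw [hy, hG] at this
    omega
  refine nonempty_mulEquiv_alternatingGroup (f := toPermHom G (orbit G y)) ?_ hcard (by decide)
    (by rw [hG]; rfl)
  rw [injective_iff_map_eq_one]
  intro g hg
  by_contra hne
  have hsub : orbit G y ⊆ fixedBy P g := fun z hz ↦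
    congrArg Subtype.val (DFunLike.congr_fun hg (⟨z, hz⟩ : orbit G y))
  have := Set.ncard_le_ncard hsub (Set.finite_of_ncard_ne_zero (by rw [hfix g hne]; decide))
  rw [hcard, hfix g hne] at this
  omega

theorem nonempty_mulEquiv_perm_four_of_orbits [Finite G] {x : Fin 3 → P}
    (hcount : ∀ A : Set G, 1 ∉ A → (∀ g, ∀ a ∈ A, g * a * g⁻¹ ∈ A) →
      2 * A.ncard = ∑ i, (orbit G (x i)).ncard * (A ∩ stabilizer G (x i)).ncard)
    (hG : Nat.card G = 24) (h0 : Nat.card (stabilizer G (x 0)) = 2)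
    (h1 : Nat.card (stabilizer G (x 1)) = 3) (h2 : Nat.card (stabilizer G (x 2)) = 4) :
    Nonempty (G ≃* Equiv.Perm (Fin 4)) := by
  have := Fact.mk Nat.prime_three
  have ho (i : Fin 3) := ncard_orbit_mul_card_stabilizer (G := G) (x i)
  have ho0 : (orbit G (x 0)).ncard = 12 := by have := ho 0; rw [h0, hG] at this; omega
  have ho1 : (orbit G (x 1)).ncard = 8 := by have := ho 1; rw [h1, hG] at this; omega
  have ho2 : (orbit G (x 2)).ncard = 6 := by have := ho 2; rw [h2, hG] at this; omega
  have hS (S : Sylow 3 G) : Nat.card S = 3 := by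
    simpa using card_sylow_eq (k := 1) (m := 8) hG (by decide) S
  have hord (S : Sylow 3 G) (g : G) (hg : g ∈ S) (hne : g ≠ 1) : orderOf g = 3 := by
    have hdvd := Subgroup.orderOf_dvd_natCard (S : Subgroup G) hg
    rw [hS S] at hdvd
    exact ((Nat.dvd_prime Nat.prime_three).1 hdvd).resolve_left (by simpa using hne)
  have hzpowers (S : Sylow 3 G) (g : G) (hg : g ∈ S) (hne : g ≠ 1) : Subgroup.zpowers g = S := by
    refine Subgroup.eq_of_le_of_card_ge (Subgroup.zpowers_le.2 hg) ?_
    rw [Nat.card_zpowers, hord S g hg hne]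
    exact (hS S).le
  have hsylow : Nat.card (Sylow 3 G) = 4 := by
    have key := card_sylow_mul_pred hS hord fun S T g hgS hgT hne ↦
      Sylow.ext ((hzpowers S g hgS hne).symm.trans (hzpowers T g hgT hne))
    have := two_mul_ncard_orderOf (p := 3) hcount
    rw [Fin.sum_univ_three, ncard_orderOf_inter_of_card_eq h1,
      ncard_orderOf_inter_of_not_dvd (by rw [h0]; decide),
      ncard_orderOf_inter_of_not_dvd (by rw [h2]; decide)] at this
    omega
  refine nonempty_mulEquiv_perm (f := toPermHom G (Sylow 3 G)) ?_ hsylow (by decide)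
    (by rw [hG]; rfl)
  rw [← MonoidHom.ker_eq_bot_iff]
  have hdvd : Nat.card (toPermHom G (Sylow 3 G)).ker ∣ 6 :=
    card_ker_toPermHom_sylow_dvd (by rw [hG, hsylow])
  have hK := two_mul_card_normal_sub_one hcount (toPermHom G (Sylow 3 G)).ker
  generalize (toPermHom G (Sylow 3 G)).ker = K at *
  have d0 : Nat.card (K ⊓ stabilizer G (x 0) : Subgroup G) ∣ 2 :=
    card_inf_dvd_of_card_eq h0
  have d1 : Nat.card (K ⊓ stabilizer G (x 1) : Subgroup G) ∣ 3 :=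
    card_inf_dvd_of_card_eq h1
  have d2 : Nat.card (K ⊓ stabilizer G (x 2) : Subgroup G) ∣ 2 ^ 2 :=
    card_inf_dvd_of_card_eq (h2.trans (by rfl))
  rw [Fin.sum_univ_three, ho0, ho1, ho2] at hK
  rw [← Subgroup.card_eq_one]
  obtain ⟨k, hk⟩ := hdvd
  have hkpos : 0 < Nat.card K := Nat.card_pos
  have h4 : Nat.card K ≠ 4 := fun h ↦ by rw [h] at hk; omega
  have hle := Nat.le_of_dvd (by decide) (Dvd.intro _ hk.symm)
  rw [Nat.dvd_prime_pow Nat.prime_two] at d2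
  obtain ⟨j, hj, d2⟩ := d2
  rw [Nat.dvd_prime Nat.prime_two] at d0
  rw [Nat.dvd_prime Nat.prime_three] at d1
  interval_cases j <;> omega

theorem card_centralizer_le [Finite G] [Finite P]
    (hfix : ∀ g : G, g ≠ 1 → (fixedBy P g).ncard = 2) {g : G} (hg : g ≠ 1) {y : P}
    (hy : g ∈ stabilizer G y) :
    Nat.card (Subgroup.centralizer {g}) ≤ 2 * Nat.card (stabilizer G y) := by
  rw [← ncard_orbit_mul_card_stabilizer (G := Subgroup.centralizer {g}) y]
  refine Nat.mul_le_mul ?_ ?_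
  · rw [← hfix g hg]
    refine Set.ncard_le_ncard ?_ (Set.toFinite _)
    rintro _ ⟨⟨c, hc⟩, rfl⟩
    change g • c • y = c • y
    rw [← mul_smul, ← Subgroup.mem_centralizer_singleton_iff.1 hc, mul_smul, hy]
  · exact Nat.card_le_card_of_injective
      (fun c ↦ (⟨c.1.1, c.2⟩ : stabilizer G y)) fun _ _ hab ↦
        Subtype.ext (Subtype.ext (congrArg (fun c : stabilizer G y ↦ (c : G)) hab))

theorem nonempty_mulEquiv_alternatingGroup_five_of_orbits [Finite G] [Finite P] {x : Fin 3 → P}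
    (hfix : ∀ g : G, g ≠ 1 → (fixedBy P g).ncard = 2) (hx : ∀ y, ∃ i, y ∈ orbit G (x i))
    (hcount : ∀ A : Set G, 1 ∉ A → (∀ g, ∀ a ∈ A, g * a * g⁻¹ ∈ A) →
      2 * A.ncard = ∑ i, (orbit G (x i)).ncard * (A ∩ stabilizer G (x i)).ncard)
    (hG : Nat.card G = 60) (h0 : Nat.card (stabilizer G (x 0)) = 2)
    (h1 : Nat.card (stabilizer G (x 1)) = 3) (h2 : Nat.card (stabilizer G (x 2)) = 5) :
    Nonempty (G ≃* alternatingGroup (Fin 5)) := by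
  have := Fact.mk Nat.prime_two
  have ho (i : Fin 3) := ncard_orbit_mul_card_stabilizer (G := G) (x i)
  have ho0 : (orbit G (x 0)).ncard = 30 := by have := ho 0; rw [h0, hG] at this; omega
  have ho1 : (orbit G (x 1)).ncard = 20 := by have := ho 1; rw [h1, hG] at this; omega
  have ho2 : (orbit G (x 2)).ncard = 12 := by have := ho 2; rw [h2, hG] at this; omega
  have hS (S : Sylow 2 G) : Nat.card S = 2 ^ 2 :=
    card_sylow_eq (m := 15) hG (by decide) S
  have hprime (g : G) (y : P) (hy : g ∈ stabilizer G y) (hne : g ≠ 1) (hdvd : orderOf g ∣ 4) :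
      orderOf g = 2 ∧ Nat.card (stabilizer G y) = 2 := by
    have hy' := Subgroup.orderOf_dvd_natCard _ hy
    have hne' : orderOf g ≠ 1 := by simpa using hne
    have hcop {q : ℕ} (hq : Nat.Coprime 4 q) (h : orderOf g ∣ q) : False :=
      hne' (Nat.eq_one_of_dvd_coprimes hq hdvd h)
    obtain ⟨i, hi⟩ := hx y
    have hi := card_stabilizer_eq_of_mem_orbit hi
    rw [hi] at hy' ⊢
    fin_cases i
    · simp only [Fin.zero_eta, h0] at hy' ⊢
      exact ⟨((Nat.dvd_prime Nat.prime_two).1 hy').resolve_left hne', trivial⟩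
    · exact (hcop (by decide) (h1 ▸ hy')).elim
    · exact (hcop (by decide) (h2 ▸ hy')).elim
  have hdvd4 (S : Sylow 2 G) (g : G) (hg : g ∈ S) : orderOf g ∣ 4 :=
    (Subgroup.orderOf_dvd_natCard (S : Subgroup G) hg).trans (hS S).dvd
  have hcentral (S : Sylow 2 G) (g : G) (hg : g ∈ S) (hne : g ≠ 1) :
      S = Subgroup.centralizer {g} := by
    refine Subgroup.eq_of_le_of_card_ge (fun h hh ↦ ?_) ?_
    · have := (IsPGroup.isMulCommutative_of_card_eq_prime_sq (hS S)).is_comm.comm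
        ⟨h, hh⟩ ⟨g, hg⟩
      exact Subgroup.mem_centralizer_singleton_iff.2 (congrArg Subtype.val this)
    · obtain ⟨y, hy⟩ := exists_mem_stabilizer_of_ne_one hfix hne
      refine (card_centralizer_le hfix hne hy).trans ?_
      rw [(hprime g y hy hne (hdvd4 S g hg)).2]
      exact (hS S).ge
  have hsylow : Nat.card (Sylow 2 G) = 5 := by
    have key := card_sylow_mul_pred hS
      (fun S g hg hne ↦ by
        obtain ⟨y, hy⟩ := exists_mem_stabilizer_of_ne_one hfix hne
        exact (hprime g y hy hne (hdvd4 S g hg)).1)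
      fun S T g hgS hgT hne ↦
        Sylow.ext ((hcentral S g hgS hne).trans (hcentral T g hgT hne).symm)
    have := two_mul_ncard_orderOf (p := 2) hcount
    rw [Fin.sum_univ_three, ncard_orderOf_inter_of_card_eq h0,
      ncard_orderOf_inter_of_not_dvd (by rw [h1]; decide),
      ncard_orderOf_inter_of_not_dvd (by rw [h2]; decide)] at this
    omega
  refine nonempty_mulEquiv_alternatingGroup (f := toPermHom G (Sylow 2 G)) ?_ hsylow (by decide)
    (by rw [hG]; rfl)
  rw [← MonoidHom.ker_eq_bot_iff]
  have hdvd : Nat.card (toPermHom G (Sylow 2 G)).ker ∣ 12 :=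
    card_ker_toPermHom_sylow_dvd (by rw [hG, hsylow])
  have hK := two_mul_card_normal_sub_one hcount (toPermHom G (Sylow 2 G)).ker
  generalize (toPermHom G (Sylow 2 G)).ker = K at *
  have d0 : Nat.card (K ⊓ stabilizer G (x 0) : Subgroup G) ∣ 2 :=
    card_inf_dvd_of_card_eq h0
  have d1 : Nat.card (K ⊓ stabilizer G (x 1) : Subgroup G) ∣ 3 :=
    card_inf_dvd_of_card_eq h1
  have d2 : Nat.card (K ⊓ stabilizer G (x 2) : Subgroup G) ∣ 5 :=
    card_inf_dvd_of_card_eq h2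
  rw [Fin.sum_univ_three, ho0, ho1, ho2] at hK
  rw [← Subgroup.card_eq_one]
  have hkpos : 0 < Nat.card K := Nat.card_pos
  have hle := Nat.le_of_dvd (by decide) hdvd
  rw [Nat.dvd_prime Nat.prime_two] at d0
  rw [Nat.dvd_prime Nat.prime_three] at d1
  rw [Nat.dvd_prime Nat.prime_five] at d2
  omega

theorem classification_of_two_fixed_points [Finite G] [Finite P]
    (hfix : ∀ g : G, g ≠ 1 → (fixedBy P g).ncard = 2) (hstab : ∀ y : P, stabilizer G y ≠ ⊥)
    (hcyc : ∀ y : P, IsCyclic (stabilizer G y)) :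
    IsCyclic G ∨
    (∃ n : ℕ, 1 ≤ n ∧ Nonempty (G ≃* DihedralGroup n)) ∨
    Nonempty (G ≃* alternatingGroup (Fin 4)) ∨
    Nonempty (G ≃* Equiv.Perm (Fin 4)) ∨
    Nonempty (G ≃* alternatingGroup (Fin 5)) := by
  rcases subsingleton_or_nontrivial G with hG | hG
  · exact .inl inferInstance
  rcases exists_stabilizer_eq_top_or_three_orbits hfix hstab with
    ⟨y, hy⟩ | ⟨x, hx, hcount, ⟨h0, h1, hG⟩ | ⟨hG, -, h1, -⟩ | ⟨hG, h0, h1, h2⟩ | ⟨hG, h0, h1, h2⟩⟩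
  · have := hcyc y
    rw [hy] at this
    exact .inl (Subgroup.topEquiv.isCyclic.1 this)
  · exact .inr (.inl ⟨_, Nat.card_pos,
      nonempty_mulEquiv_dihedralGroup_of_orbits hfix hcyc hx h0 h1 hG⟩)
  · exact .inr (.inr (.inl (nonempty_mulEquiv_alternatingGroup_four_of_orbit hfix hG h1)))
  · exact .inr (.inr (.inr (.inl (nonempty_mulEquiv_perm_four_of_orbits hcount hG h0 h1 h2))))
  · exact .inr (.inr (.inr (.inr
      (nonempty_mulEquiv_alternatingGroup_five_of_orbits hfix hx hcount hG h0 h1 h2))))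

end GroupTheory

section Rotation

theorem adjugate_eq_transpose {A : Matrix (Fin 3) (Fin 3) ℝ} (hA : Aᵀ * A = 1) (hdet : A.det = 1) :
    A.adjugate = Aᵀ := by
  have h := mul_adjugate A
  rw [hdet, one_smul] at h
  rw [← one_mul A.adjugate, ← hA, mul_assoc, h, mul_one]

theorem mulVec_cross_mulVec {A : Matrix (Fin 3) (Fin 3) ℝ} (hA : Aᵀ * A = 1) (hdet : A.det = 1)
    (v w : Fin 3 → ℝ) : (A *ᵥ v) ⨯₃ (A *ᵥ w) = A *ᵥ (v ⨯₃ w) := by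
  have h : (A *ᵥ v) ⨯₃ (A *ᵥ w) = A.adjugateᵀ *ᵥ (v ⨯₃ w) := by
    rw [adjugate_fin_three]
    ext i
    fin_cases i <;>
      simp [cross_apply, mulVec, dotProduct, Fin.sum_univ_three] <;> ring
  rw [h, adjugate_eq_transpose hA hdet, transpose_transpose]

theorem mulVec_dotProduct_mulVec {A : Matrix (Fin 3) (Fin 3) ℝ} (hA : Aᵀ * A = 1)
    (v w : Fin 3 → ℝ) : (A *ᵥ v) ⬝ᵥ (A *ᵥ w) = v ⬝ᵥ w := by
  rw [dotProduct_mulVec, ← mulVec_transpose, mulVec_mulVec, hA, one_mulVec]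

/-- A rotation fixing two linearly independent vectors is the identity. -/
theorem eq_one_of_mulVec_eq {A : Matrix (Fin 3) (Fin 3) ℝ} (hA : Aᵀ * A = 1) (hdet : A.det = 1)
    {v w : Fin 3 → ℝ} (hv : A *ᵥ v = v) (hw : A *ᵥ w = w) (hvw : v ⨯₃ w ≠ 0) : A = 1 := by
  have hu := mulVec_cross_mulVec hA hdet v w
  rw [hv, hw] at hu
  have hM : (of ![v ⨯₃ w, v, w]).det ≠ 0 := by
    have := triple_product_eq_det (v ⨯₃ w) v w
    change _ = (of ![v ⨯₃ w, v, w]).det at this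
    rw [← this]
    exact fun h ↦ hvw (dotProduct_self_eq_zero.1 h)
  have hMA : of ![v ⨯₃ w, v, w] * Aᵀ = of ![v ⨯₃ w, v, w] := by
    ext i j
    rw [← transpose_apply (_ * _), transpose_mul, transpose_transpose]
    fin_cases i
    · exact congrFun hu.symm j
    · exact congrFun hv j
    · exact congrFun hw j
  have h1 : IsUnit (of ![v ⨯₃ w, v, w]) := (isUnit_iff_isUnit_det _).2 (isUnit_iff_ne_zero.2 hM)
  rw [← transpose_inj, transpose_one]
  exact h1.mul_left_cancel (hMA.trans (mul_one _).symm)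

theorem eq_or_eq_neg_of_cross_eq_zero {v w : Fin 3 → ℝ} (hv : v ⬝ᵥ v = 1) (hw : w ⬝ᵥ w = 1)
    (h : v ⨯₃ w = 0) : w = v ∨ w = -v := by
  have hcross := cross_cross_eq_smul_sub_smul v w v
  rw [h, map_zero, LinearMap.zero_apply, hv, one_smul] at hcross
  have hwv : w = (w ⬝ᵥ v) • v := (sub_eq_zero.1 hcross.symm)
  have hsq : (w ⬝ᵥ v) * (w ⬝ᵥ v) = 1 := by
    rw [hwv, smul_dotProduct, dotProduct_smul, hv] at hw
    simpa using hw
  rcases mul_self_eq_one_iff.1 hsq with h1 | h1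
  · left
    rw [hwv, h1, one_smul]
  · right
    rw [hwv, h1, neg_one_smul]

theorem inv_sqrt_smul_dotProduct_self {v : Fin 3 → ℝ} (hv : v ≠ 0) :
    ((√(v ⬝ᵥ v))⁻¹ • v) ⬝ᵥ ((√(v ⬝ᵥ v))⁻¹ • v) = 1 := by
  have hpos : 0 < v ⬝ᵥ v := by
    refine lt_of_le_of_ne ?_ fun h ↦ hv (dotProduct_self_eq_zero.1 h.symm)
    exact Finset.sum_nonneg fun i _ ↦ mul_self_nonneg (v i)
  rw [smul_dotProduct, dotProduct_smul, smul_eq_mul, smul_eq_mul, ← mul_assoc, ← mul_inv,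
    Real.mul_self_sqrt hpos.le, inv_mul_cancel₀ hpos.ne']

/-- Euler's rotation theorem: every rotation has an axis. -/
theorem exists_unit_mulVec_eq {A : Matrix (Fin 3) (Fin 3) ℝ} (hA : Aᵀ * A = 1)
    (hdet : A.det = 1) : ∃ v : Fin 3 → ℝ, v ⬝ᵥ v = 1 ∧ A *ᵥ v = v := by
  have h0 : (A - 1).det = 0 := by
    have h : (A - 1)ᵀ * A = -(A - 1) := by
      rw [transpose_sub, transpose_one, sub_mul, hA, one_mul, neg_sub]
    have := congrArg det h
    rw [det_mul, det_transpose, hdet, det_neg, mul_one, Fintype.card_fin] at this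
    linarith
  obtain ⟨v, hv, hAv⟩ := exists_mulVec_eq_zero_iff.2 h0
  rw [sub_mulVec, one_mulVec, sub_eq_zero] at hAv
  exact ⟨_, inv_sqrt_smul_dotProduct_self hv, by rw [mulVec_smul, hAv]⟩

theorem exists_unit_dotProduct_eq_zero (v : Fin 3 → ℝ) :
    ∃ u : Fin 3 → ℝ, u ⬝ᵥ u = 1 ∧ u ⬝ᵥ v = 0 := by
  obtain ⟨u, hu, huv⟩ : ∃ u : Fin 3 → ℝ, u ≠ 0 ∧ u ⬝ᵥ v = 0 := by
    by_cases h : v 0 = 0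
    · exact ⟨![1, 0, 0], fun h ↦ by simpa using congrFun h 0, by simp [dotProduct,
        Fin.sum_univ_three, h]⟩
    · exact ⟨![-v 1, v 0, 0], fun h' ↦ h (by simpa using congrFun h' 1), by
        simp [dotProduct, Fin.sum_univ_three]; ring⟩
  exact ⟨_, inv_sqrt_smul_dotProduct_self hu, by rw [smul_dotProduct, huv, smul_zero]⟩

/-- Expansion of a vector orthogonal to `v` in the orthonormal basis `u`, `v ⨯₃ u` of the plane
orthogonal to `v`. -/
theorem eq_smul_add_smul_cross {u v x : Fin 3 → ℝ} (hv : v ⬝ᵥ v = 1) (hu : u ⬝ᵥ u = 1)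
    (huv : u ⬝ᵥ v = 0) (hx : x ⬝ᵥ v = 0) :
    x = (u ⬝ᵥ x) • u + ((v ⨯₃ u) ⬝ᵥ x) • (v ⨯₃ u) := by
  have hvw : v ⨯₃ (v ⨯₃ u) = -u := by
    rw [cross_cross_eq_smul_sub_smul', hv, dotProduct_comm v u, huv]
    simp
  have huw : u ⨯₃ (v ⨯₃ u) = v := by
    rw [cross_cross_eq_smul_sub_smul', hu, dotProduct_comm v u, huv]
    simp
  have h1 : x ⨯₃ v = (x ⬝ᵥ (v ⨯₃ u)) • u - (x ⬝ᵥ u) • (v ⨯₃ u) := by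
    conv_lhs => rw [← huw]
    rw [cross_cross_eq_smul_sub_smul']
    simp [dotProduct_comm]
  have h2 : v ⨯₃ (x ⨯₃ v) = x := by
    rw [cross_cross_eq_smul_sub_smul', hv, hx]
    simp
  rw [h1, map_sub, map_smul, map_smul, hvw] at h2
  rw [dotProduct_comm u, dotProduct_comm _ x]
  conv_lhs => rw [← h2]
  module

/-- A finite group acting faithfully by rotations about a common axis is cyclic. -/
theorem isCyclic_of_mulVec_eq {K : Type*} [Group K] [Finite K] {ρ : K →* Matrix (Fin 3) (Fin 3) ℝ}
    (hinj : Function.Injective ρ) (horth : ∀ k, (ρ k)ᵀ * ρ k = 1) (hdet : ∀ k, (ρ k).det = 1)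
    {v : Fin 3 → ℝ} (hv : v ⬝ᵥ v = 1) (hfix : ∀ k, ρ k *ᵥ v = v) : IsCyclic K := by
  obtain ⟨u, hu, huv⟩ := exists_unit_dotProduct_eq_zero v
  obtain ⟨w, hw⟩ : ∃ w, w = v ⨯₃ u := ⟨_, rfl⟩
  have huw : u ⬝ᵥ w = 0 := hw ▸ dot_cross_self v u
  have hww : w ⬝ᵥ w = 1 := by
    rw [hw, cross_dot_cross, hu, hv, huv]
    simp
  have hvw : v ⨯₃ w = -u := by
    rw [hw, cross_cross_eq_smul_sub_smul', hv, dotProduct_comm v u, huv]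
    simp
  have hku (k : K) : ρ k *ᵥ u = (u ⬝ᵥ ρ k *ᵥ u) • u + (w ⬝ᵥ ρ k *ᵥ u) • w := by
    rw [hw]
    refine eq_smul_add_smul_cross hv hu huv ?_
    conv_lhs => rw [← hfix k]
    rw [mulVec_dotProduct_mulVec (horth k), huv]
  have hkw (k : K) : ρ k *ᵥ w = (u ⬝ᵥ ρ k *ᵥ u) • w - (w ⬝ᵥ ρ k *ᵥ u) • u := by
    conv_lhs => rw [hw, ← mulVec_cross_mulVec (horth k) (hdet k), hfix, hku k]
    rw [map_add, map_smul, map_smul, hvw, ← hw]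
    module
  let χ : K →* ℂ :=
    { toFun := fun k ↦ ⟨u ⬝ᵥ ρ k *ᵥ u, w ⬝ᵥ ρ k *ᵥ u⟩
      map_one' := by
        rw [map_one, one_mulVec, hu, dotProduct_comm, huw]
        rfl
      map_mul' := fun k l ↦ by
        have h : ρ (k * l) *ᵥ u = (u ⬝ᵥ ρ l *ᵥ u) • ρ k *ᵥ u + (w ⬝ᵥ ρ l *ᵥ u) • ρ k *ᵥ w := by
          rw [map_mul, ← mulVec_mulVec, ← mulVec_smul, ← mulVec_smul, ← mulVec_add, ← hku l]
        rw [h, hkw k]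
        apply Complex.ext <;>
          simp only [dotProduct_add, dotProduct_smul, dotProduct_sub, huw, hu, hww,
            dotProduct_comm w u, Complex.mul_re, Complex.mul_im, smul_eq_mul] <;> ring }
  refine isCyclic_of_injective_ringHom χ ?_
  rw [injective_iff_map_eq_one]
  intro k hk
  have hre : u ⬝ᵥ ρ k *ᵥ u = 1 := congrArg Complex.re hk
  have him : w ⬝ᵥ ρ k *ᵥ u = 0 := congrArg Complex.im hk
  have hfixu := hku k
  rw [hre, him, one_smul, zero_smul, add_zero] at hfixu
  refine hinj (((eq_one_of_mulVec_eq (horth k) (hdet k) (hfix k) hfixu) ?_).trans (map_one ρ).symm)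
  rw [← hw]
  rintro rfl
  simp at hww

variable {G : Type*} [Group G]

/-- The unit vectors on the axes of the non-trivial rotations in a group. -/
def poles (ρ : G →* Matrix (Fin 3) (Fin 3) ℝ) : Set (Fin 3 → ℝ) :=
  {v | v ⬝ᵥ v = 1 ∧ ∃ g, g ≠ 1 ∧ ρ g *ᵥ v = v}

/-- The action of a group of rotations on its poles. -/
@[reducible]
def polesMulAction {ρ : G →* Matrix (Fin 3) (Fin 3) ℝ} (horth : ∀ g, (ρ g)ᵀ * ρ g = 1) :
    MulAction G (poles ρ) where
  smul g v := ⟨ρ g *ᵥ v, by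
    obtain ⟨hv, k, hk, hkv⟩ := v.2
    refine ⟨by rw [mulVec_dotProduct_mulVec (horth g), hv], g * k * g⁻¹, by simpa using hk, ?_⟩
    rw [mulVec_mulVec, ← map_mul, inv_mul_cancel_right, map_mul, ← mulVec_mulVec, hkv]⟩
  one_smul v := Subtype.ext (by
    change ρ 1 *ᵥ _ = _
    rw [map_one, one_mulVec])
  mul_smul g h v := Subtype.ext (by
    change ρ (g * h) *ᵥ _ = ρ g *ᵥ (ρ h *ᵥ _)
    rw [map_mul, mulVec_mulVec])

theorem exists_fixed_unit_vectors_eq_pair {A : Matrix (Fin 3) (Fin 3) ℝ} (hA : Aᵀ * A = 1)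
    (hdet : A.det = 1) (hne : A ≠ 1) :
    ∃ v : Fin 3 → ℝ, v ≠ -v ∧ {w | w ⬝ᵥ w = 1 ∧ A *ᵥ w = w} = {v, -v} := by
  obtain ⟨v, hv, hAv⟩ := exists_unit_mulVec_eq hA hdet
  refine ⟨v, fun h ↦ ?_, ?_⟩
  · rw [self_eq_neg.1 h] at hv
    simp at hv
  · ext w
    constructor
    · rintro ⟨hw, hAw⟩
      refine eq_or_eq_neg_of_cross_eq_zero hv hw ?_
      by_contra h
      exact hne (eq_one_of_mulVec_eq hA hdet hAv hAw h)
    · rintro (rfl | rfl)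
      · exact ⟨hv, hAv⟩
      · exact ⟨by simpa using hv, by rw [mulVec_neg, hAv]⟩

theorem finite_poles [Finite G] {ρ : G →* Matrix (Fin 3) (Fin 3) ℝ}
    (hinj : Function.Injective ρ) (horth : ∀ g, (ρ g)ᵀ * ρ g = 1) (hdet : ∀ g, (ρ g).det = 1) :
    (poles ρ).Finite := by
  have hsub : poles ρ ⊆ ⋃ g : {g : G // g ≠ 1}, {w | w ⬝ᵥ w = 1 ∧ ρ g *ᵥ w = w} := by
    rintro v ⟨hv, g, hg, hgv⟩
    exact Set.mem_iUnion.2 ⟨⟨g, hg⟩, hv, hgv⟩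
  refine (Set.finite_iUnion fun g ↦ ?_).subset hsub
  obtain ⟨v, -, h⟩ := exists_fixed_unit_vectors_eq_pair (horth g) (hdet g)
    fun h ↦ g.2 (hinj (h.trans (map_one ρ).symm))
  rw [h]
  exact Set.toFinite _

theorem classification_of_faithful_rotations [Finite G] {ρ : G →* Matrix (Fin 3) (Fin 3) ℝ}
    (hinj : Function.Injective ρ) (horth : ∀ g, (ρ g)ᵀ * ρ g = 1) (hdet : ∀ g, (ρ g).det = 1) :
    IsCyclic G ∨
    (∃ n : ℕ, 1 ≤ n ∧ Nonempty (G ≃* DihedralGroup n)) ∨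
    Nonempty (G ≃* alternatingGroup (Fin 4)) ∨
    Nonempty (G ≃* Equiv.Perm (Fin 4)) ∨
    Nonempty (G ≃* alternatingGroup (Fin 5)) := by
  let := polesMulAction horth
  have := (finite_poles hinj horth hdet).to_subtype
  have hsmul {g : G} {v : poles ρ} : g • v = v ↔ ρ g *ᵥ v = v := Subtype.ext_iff
  refine classification_of_two_fixed_points (P := poles ρ) (fun g hg ↦ ?_) (fun v ↦ ?_)
    (fun v ↦ ?_)
  · obtain ⟨v, hv, h⟩ := exists_fixed_unit_vectors_eq_pair (horth g) (hdet g)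
      fun h ↦ hg (hinj (h.trans (map_one ρ).symm))
    rw [← Set.ncard_pair hv, ← h, ← Set.ncard_image_of_injective _ Subtype.val_injective]
    congr 1
    ext w
    constructor
    · rintro ⟨w, hw, rfl⟩
      exact ⟨w.2.1, hsmul.1 hw⟩
    · rintro ⟨hw, hgw⟩
      exact ⟨⟨w, hw, g, hg, hgw⟩, hsmul.2 hgw, rfl⟩
  · obtain ⟨-, g, hg, hgv⟩ := v.2
    exact fun h ↦ hg ((Subgroup.eq_bot_iff_forall _).1 h g (hsmul.2 hgv))
  · exact isCyclic_of_mulVec_eq (ρ := ρ.comp (MulAction.stabilizer G v).subtype)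
      (hinj.comp Subtype.val_injective) (fun k ↦ horth k) (fun k ↦ hdet k) v.2.1
      fun k ↦ hsmul.1 k.2

end Rotation

/-- Every finite subgroup of `SO(3)` is isomorphic to a cyclic group, a dihedral group,
`A₄`, `S₄`, or `A₅`. -/
theorem finite_subgroups_SO3 (H : Subgroup (Matrix.orthogonalGroup (Fin 3) ℝ)) [Finite H]
    (hdet : ∀ A ∈ H, (A : Matrix (Fin 3) (Fin 3) ℝ).det = 1) :
    IsCyclic H ∨
    (∃ n : ℕ, 1 ≤ n ∧ Nonempty (H ≃* DihedralGroup n)) ∨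
    Nonempty (H ≃* alternatingGroup (Fin 4)) ∨
    Nonempty (H ≃* Equiv.Perm (Fin 4)) ∨
    Nonempty (H ≃* alternatingGroup (Fin 5)) :=
  classification_of_faithful_rotations
    (ρ := (Submonoid.subtype (orthogonalGroup (Fin 3) ℝ)).comp H.subtype)
    (Subtype.val_injective.comp Subtype.val_injective)
    (fun g ↦ (mem_orthogonalGroup_iff' (Fin 3) ℝ).1 g.1.2) (fun g ↦ hdet g.1 g.2)
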